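/- arXiv:1507.07006 — 8 statements merged into one kernel-verified Lean document; each statement's English description precedes it below -/
import Mathlib

section
/- Let (X,d) be a metric space and let μ be a Borel regular outer measure on X that is positive and finite on all balls and satisfies the annulus decay property: there exist constants C > 0 and δ > 0 such that μ(B(x,(1+ε)r) \ B(x,r)) ≤ C·μ(B(x,r))·ε^δ for every x ∈ X, r > 0 and ε > 0. Let Ω ⊂ X be open and let u ∈ L¹(Ω). Then for each fixed r > 0 the map ∂Ω ∋ x ↦ (1/μ(Ω∩B(x,r)))·∫_{Ω∩B(x,r)} u dμ is a well-defined real-valued continuous function on ∂Ω. Consequently, the set D of points x ∈ ∂Ω at which the trace value Tu(x) of u exists is a Borel set, and Tu is a Borel measurable function on D. -/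
open Metric MeasureTheory Filter Topology Set ENNReal

/-- The set of boundary points of `Ω` at which the trace value of `u` exists, i.e. points
`x ∈ ∂Ω` for which there is `a ∈ ℝ` with
`lim_{r→0⁺} ⨍_{Ω∩B(x,r)} |u − a| dμ = 0`. -/
def traceExistsSet {X : Type*} [MetricSpace X] [MeasurableSpace X]
    (μ : Measure X) (Ω : Set X) (u : X → ℝ) : Set X :=
  {x | x ∈ frontier Ω ∧ ∃ a : ℝ,
    Tendsto (fun r : ℝ => ⨍ y in Ω ∩ ball x r, |u y - a| ∂μ) (𝓝[>] 0) (𝓝 0)}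

section SetAverage

variable {α : Type*} [MeasurableSpace α] {μ : Measure α} {s : Set α} {u : α → ℝ}

theorem integrableOn_abs_sub_const (hs : μ s ≠ ∞) (hu : IntegrableOn u s μ) (a : ℝ) :
    IntegrableOn (fun y => |u y - a|) s μ :=
  (hu.sub (integrableOn_const hs)).abs

theorem setAverage_mono_of_le {f g : α → ℝ} (hf : IntegrableOn f s μ) (hg : IntegrableOn g s μ)
    (h : ∀ y, f y ≤ g y) : ⨍ y in s, f y ∂μ ≤ ⨍ y in s, g y ∂μ := by
  rw [setAverage_eq, setAverage_eq, smul_eq_mul, smul_eq_mul]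
  exact mul_le_mul_of_nonneg_left (integral_mono hf hg h) (inv_nonneg.2 measureReal_nonneg)

theorem setAverage_add {f g : α → ℝ} (hf : IntegrableOn f s μ) (hg : IntegrableOn g s μ) :
    ⨍ y in s, (f y + g y) ∂μ = (⨍ y in s, f y ∂μ) + ⨍ y in s, g y ∂μ := by
  simp only [setAverage_eq, smul_eq_mul]
  rw [integral_add hf hg, mul_add]

theorem setAverage_abs_nonneg (f : α → ℝ) : 0 ≤ ⨍ y in s, |f y| ∂μ := by
  rw [setAverage_eq, smul_eq_mul]
  exact mul_nonneg (inv_nonneg.2 measureReal_nonneg) (integral_nonneg fun y => abs_nonneg _)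

theorem abs_sub_le_setAverage_add (hs₀ : μ s ≠ 0) (hs : μ s ≠ ∞) (hu : IntegrableOn u s μ)
    (a b : ℝ) : |a - b| ≤ (⨍ y in s, |u y - a| ∂μ) + ⨍ y in s, |u y - b| ∂μ := by
  have ha := integrableOn_abs_sub_const hs hu a
  have hb := integrableOn_abs_sub_const hs hu b
  rw [← setAverage_add ha hb, ← setAverage_const hs₀ hs |a - b|]
  refine setAverage_mono_of_le (integrableOn_const hs) (ha.add hb) fun y => ?_
  rw [abs_sub_comm (u y) a]
  exact abs_sub_le a (u y) b

theorem setAverage_abs_sub_le (hs₀ : μ s ≠ 0) (hs : μ s ≠ ∞) (hu : IntegrableOn u s μ)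
    (a b : ℝ) : ⨍ y in s, |u y - a| ∂μ ≤ (⨍ y in s, |u y - b| ∂μ) + |b - a| := by
  have ha := integrableOn_abs_sub_const hs hu a
  have hb := integrableOn_abs_sub_const hs hu b
  have hc : IntegrableOn (fun _ => |b - a|) s μ := integrableOn_const hs
  rw [← setAverage_const hs₀ hs |b - a|, ← setAverage_add hb hc]
  exact setAverage_mono_of_le ha (hb.add hc) fun y => abs_sub_le (u y) b a

theorem abs_setAverage_sub_le (hs₀ : μ s ≠ 0) (hs : μ s ≠ ∞) (hu : IntegrableOn u s μ)
    (a : ℝ) : |(⨍ y in s, u y ∂μ) - a| ≤ ⨍ y in s, |u y - a| ∂μ := by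
  have hc : ∀ c : ℝ, IntegrableOn (fun _ => c) s μ := fun c => integrableOn_const hs
  have ha := integrableOn_abs_sub_const hs hu a
  rw [abs_sub_le_iff, sub_le_iff_le_add, sub_le_comm, sub_le_iff_le_add']
  constructor
  · have hadd := setAverage_add ha (hc a)
    rw [setAverage_const hs₀ hs a] at hadd
    rw [← hadd]
    refine setAverage_mono_of_le hu (ha.add (hc a)) fun y => ?_
    linarith [le_abs_self (u y - a)]
  · rw [← setAverage_add ha hu]
    conv_lhs => rw [← setAverage_const hs₀ hs a]
    refine setAverage_mono_of_le (hc a) (ha.add hu) fun y => ?_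
    linarith [neg_abs_le (u y - a)]

end SetAverage

/-- Under the annulus decay property, spheres are null sets. -/
theorem measure_sphere_eq_zero_of_annulus_decay {X : Type*} [MetricSpace X] [MeasurableSpace X]
    {μ : Measure X} {C δ : ℝ} (hδ : 0 < δ) {x : X} {r : ℝ} (hr : 0 < r)
    (hfin : μ (ball x r) ≠ ∞)
    (hann : ∀ ε : ℝ, 0 < ε →
      μ (ball x ((1 + ε) * r) \ ball x r) ≤ ENNReal.ofReal (C * ε ^ δ) * μ (ball x r)) :
    μ (sphere x r) = 0 := by
  have hle : ∀ ε : ℝ, 0 < ε → μ (sphere x r) ≤ ENNReal.ofReal (C * ε ^ δ) * μ (ball x r) := by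
    intro ε hε
    refine (measure_mono fun y hy => ?_).trans (hann ε hε)
    rw [mem_sphere] at hy
    refine ⟨mem_ball.2 ?_, fun h => (mem_ball.1 h).ne hy⟩
    rw [hy]
    nlinarith
  have hpow : Tendsto (fun ε : ℝ => C * ε ^ δ) (𝓝[>] 0) (𝓝 0) := by
    have h := ((Real.continuousAt_rpow_const 0 δ (Or.inr hδ.le)).tendsto.const_mul C).mono_left
      (nhdsWithin_le_nhds (s := Ioi 0))
    simpa [Real.zero_rpow hδ.ne'] using h
  have hlim : Tendsto (fun ε : ℝ => ENNReal.ofReal (C * ε ^ δ) * μ (ball x r))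
      (𝓝[>] 0) (𝓝 0) := by
    have h := ENNReal.Tendsto.mul_const (ENNReal.tendsto_ofReal hpow) (Or.inr hfin)
    simpa using h
  exact le_antisymm (ge_of_tendsto hlim (eventually_mem_nhdsWithin.mono hle)) bot_le

/-- If the sphere of radius `r` about `x` is null, integrals over balls of radius `r` depend
continuously on the centre at `x`. -/
theorem continuousAt_setIntegral_ball {X : Type*} [MetricSpace X] [MeasurableSpace X]
    [BorelSpace X] {μ : Measure X} {Ω : Set X} (hΩ : MeasurableSet Ω) {f : X → ℝ} {x : X} {r : ℝ}
    (hsphere : μ (sphere x r) = 0) (hf : IntegrableOn f (Ω ∩ ball x (r + 1)) μ) :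
    ContinuousAt (fun z => ∫ y in Ω ∩ ball z r, f y ∂μ) x := by
  have hind : ∀ z : X, ∫ y in Ω ∩ ball z r, f y ∂μ
      = ∫ y, (Ω ∩ ball z r).indicator f y ∂μ := fun z =>
    (integral_indicator (hΩ.inter measurableSet_ball)).symm
  simp only [ContinuousAt, hind]
  have hsub : ∀ᶠ z in 𝓝 x, Ω ∩ ball z r ⊆ Ω ∩ ball x (r + 1) := by
    filter_upwards [ball_mem_nhds x one_pos] with z hz
    refine inter_subset_inter_right _ (ball_subset_ball' ?_)
    linarith [mem_ball.1 hz]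
  refine tendsto_integral_filter_of_dominated_convergence
    ((Ω ∩ ball x (r + 1)).indicator fun y => ‖f y‖) ?_ ?_ ?_ ?_
  · filter_upwards [hsub] with z hz
    exact (aestronglyMeasurable_indicator_iff (hΩ.inter measurableSet_ball)).2
      (hf.mono_set hz).1
  · filter_upwards [hsub] with z hz
    refine Eventually.of_forall fun y => ?_
    rw [norm_indicator_eq_indicator_norm]
    exact indicator_le_indicator_of_subset hz (fun _ => norm_nonneg _) y
  · exact (integrable_indicator_iff (hΩ.inter measurableSet_ball)).2 hf.norm
  · have hne : ∀ᵐ y ∂μ, y ∉ sphere x r := measure_eq_zero_iff_ae_notMem.1 hsphere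
    filter_upwards [hne] with y hy
    have hdist : Tendsto (fun z => dist y z) (𝓝 x) (𝓝 (dist y x)) :=
      tendsto_const_nhds.dist tendsto_id
    refine tendsto_const_nhds.congr' ?_
    rcases lt_or_gt_of_ne (show dist y x ≠ r from hy) with h | h
    · filter_upwards [hdist.eventually_lt_const h] with z hz
      classical simp [indicator_apply, h, hz]
    · filter_upwards [hdist.eventually_const_lt h] with z hz
      simp [h.not_gt, hz.not_gt]

/-- Let `μ` be a Borel measure on a metric space `X`, positive and finite on balls, and
satisfying the annulus decay property
`μ(B(x,(1+ε)r) \ B(x,r)) ≤ C·μ(B(x,r))·ε^δ`.  Let `Ω ⊆ X` be open and `u ∈ L¹(Ω)`.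
Then for each `r > 0` the map `x ↦ ⨍_{Ω∩B(x,r)} u dμ` is a well-defined real-valued
continuous function on `∂Ω`; consequently the set `D` of boundary points where the trace
value of `u` exists is Borel, and the trace function is Borel measurable on `D`. -/
theorem trace_borel_measurable {X : Type*} [MetricSpace X] [MeasurableSpace X] [BorelSpace X]
    (μ : Measure X)
    (hpos : ∀ (x : X) (r : ℝ), 0 < r → 0 < μ (ball x r) ∧ μ (ball x r) ≠ ∞)
    (C δ : ℝ) (hC : 0 < C) (hδ : 0 < δ)
    (hann : ∀ (x : X) (r ε : ℝ), 0 < r → 0 < ε →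
      μ (ball x ((1 + ε) * r) \ ball x r) ≤ ENNReal.ofReal (C * ε ^ δ) * μ (ball x r))
    (Ω : Set X) (hΩ : IsOpen Ω) (u : X → ℝ) (hu : IntegrableOn u Ω μ) :
    (∀ r : ℝ, 0 < r →
      (∀ x ∈ frontier Ω, 0 < μ (Ω ∩ ball x r) ∧ μ (Ω ∩ ball x r) ≠ ∞) ∧
      ContinuousOn (fun x => ⨍ y in Ω ∩ ball x r, u y ∂μ) (frontier Ω)) ∧
    MeasurableSet (traceExistsSet μ Ω u) ∧
    ∃ T : X → ℝ,
      (∀ x ∈ traceExistsSet μ Ω u,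
        Tendsto (fun r : ℝ => ⨍ y in Ω ∩ ball x r, |u y - T x| ∂μ) (𝓝[>] 0) (𝓝 0)) ∧
      Measurable (fun p : traceExistsSet μ Ω u => T ↑p) := by
  have hfin : ∀ (x : X) (r : ℝ), μ (Ω ∩ ball x r) ≠ ∞ := by
    intro x r
    refine measure_ne_top_of_subset
      (inter_subset_right.trans (ball_subset_ball (le_max_left r 1))) (hpos x (max r 1) ?_).2
    positivity
  have hmass : ∀ x ∈ frontier Ω, ∀ r : ℝ, 0 < r → 0 < μ (Ω ∩ ball x r) := by
    intro x hx r hr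
    obtain ⟨y, hy, hyr⟩ := mem_closure_iff.1 (frontier_subset_closure hx) _ isOpen_ball
      (mem_ball_self hr)
    obtain ⟨t, ht, hsub⟩ := isOpen_iff.1 (hΩ.inter isOpen_ball) y ⟨hyr, hy⟩
    exact (hpos y t ht).1.trans_le (measure_mono hsub)
  have hint : ∀ (x : X) (r : ℝ), IntegrableOn u (Ω ∩ ball x r) μ := fun x r =>
    hu.mono_set inter_subset_left
  have hcont : ∀ (f : X → ℝ), (∀ x r, IntegrableOn f (Ω ∩ ball x r) μ) → ∀ r : ℝ, 0 < r →
      ContinuousOn (fun x => ⨍ y in Ω ∩ ball x r, f y ∂μ) (frontier Ω) := by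
    intro f hf r hr x hx
    have hsphere : μ (sphere x r) = 0 :=
      measure_sphere_eq_zero_of_annulus_decay hδ hr (hpos x r hr).2 fun ε => hann x r ε hr
    have hone := continuousAt_setIntegral_ball (f := fun _ => 1) hΩ.measurableSet hsphere
      (integrableOn_const (hfin x (r + 1)))
    simp only [setIntegral_const, smul_eq_mul, mul_one] at hone
    simp only [setAverage_eq, smul_eq_mul]
    have hne : μ.real (Ω ∩ ball x r) ≠ 0 :=
      (ENNReal.toReal_pos (hmass x hx r hr).ne' (hfin x r)).ne'
    exact ((hone.inv₀ hne).mul (continuousAt_setIntegral_ball hΩ.measurableSet hsphere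
      (hf x (r + 1)))).continuousWithinAt
  have hD : traceExistsSet μ Ω u = ⋂ n : ℕ, ⋃ q : ℚ, ⋃ m : ℕ,
      frontier Ω ∩ ⋂ r ∈ Ioo (0 : ℝ) (1 / (m + 1)),
        {x ∈ frontier Ω | ⨍ y in Ω ∩ ball x r, |u y - q| ∂μ ≤ 1 / ((n : ℝ) + 1)} := by
    ext x
    simp only [mem_iInter, mem_iUnion, mem_inter_iff, mem_ofPred_eq, traceExistsSet]
    constructor
    · rintro ⟨hx, a, ha⟩ n
      have hn : (0 : ℝ) < 1 / ((n : ℝ) + 1) := Nat.one_div_pos_of_nat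
      obtain ⟨q, hq₁, hq₂⟩ := exists_rat_btwn (lt_add_of_pos_right a (half_pos hn))
      obtain ⟨t, ht, hsub⟩ := mem_nhdsGT_iff_exists_Ioo_subset.1
        (ha.eventually_lt_const (half_pos hn))
      obtain ⟨m, hm⟩ := exists_nat_one_div_lt (mem_Ioi.1 ht)
      refine ⟨q, m, hx, fun r hr => ⟨hx, ?_⟩⟩
      have h₁ : ⨍ y in Ω ∩ ball x r, |u y - a| ∂μ < 1 / ((n : ℝ) + 1) / 2 :=
        hsub ⟨hr.1, hr.2.trans hm⟩
      have h₂ := setAverage_abs_sub_le (hmass x hx r hr.1).ne' (hfin x r) (hint x r) q a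
      rw [abs_sub_comm, abs_of_pos (sub_pos.2 hq₁)] at h₂
      linarith
    · intro h
      choose q m hx hq using h
      have hx := hx 0
      have hev : ∀ n : ℕ, ∀ᶠ r in 𝓝[>] (0 : ℝ),
          0 < r ∧ ⨍ y in Ω ∩ ball x r, |u y - q n| ∂μ ≤ 1 / ((n : ℝ) + 1) := fun n => by
        filter_upwards [Ioo_mem_nhdsGT (Nat.one_div_pos_of_nat (α := ℝ) (n := m n))] with r hr
        exact ⟨hr.1, (hq n r hr).2⟩
      have hdist : ∀ n k : ℕ, |(q n : ℝ) - q k| ≤ 1 / ((n : ℝ) + 1) + 1 / ((k : ℝ) + 1) := by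
        intro n k
        obtain ⟨r, ⟨hr, hn⟩, -, hk⟩ := ((hev n).and (hev k)).exists
        exact (abs_sub_le_setAverage_add (hmass x hx r hr).ne' (hfin x r) (hint x r)
          _ _).trans (add_le_add hn hk)
      have hcauchy : CauchySeq fun n => (q n : ℝ) := by
        refine cauchySeq_of_le_tendsto_0 (fun n : ℕ => 2 * (1 / ((n : ℝ) + 1)))
          (fun n k N hn hk => ?_) ?_
        · rw [Real.dist_eq]
          have h₁ := Nat.one_div_le_one_div (α := ℝ) hn
          have h₂ := Nat.one_div_le_one_div (α := ℝ) hk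
          linarith [hdist n k]
        · simpa using (tendsto_one_div_add_atTop_nhds_zero_nat (𝕜 := ℝ)).const_mul 2
      obtain ⟨a, ha⟩ := cauchySeq_tendsto_of_complete hcauchy
      refine ⟨hx, a, tendsto_order.2 ⟨fun b hb => Eventually.of_forall fun r =>
        hb.trans_le (setAverage_abs_nonneg _), fun b hb => ?_⟩⟩
      have hsum : Tendsto (fun n : ℕ => 1 / ((n : ℝ) + 1) + |(q n : ℝ) - a|) atTop (𝓝 0) := by
        simpa using (tendsto_one_div_add_atTop_nhds_zero_nat (𝕜 := ℝ)).add
          (ha.sub_const a).abs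
      obtain ⟨n, hn⟩ := (hsum.eventually_lt_const hb).exists
      filter_upwards [hev n] with r hr
      have := setAverage_abs_sub_le (hmass x hx r hr.1).ne' (hfin x r) (hint x r) a (q n)
      linarith [hr.2]
  refine ⟨fun r hr => ⟨fun x hx => ⟨hmass x hx r hr, hfin x r⟩, hcont u hint r hr⟩, ?_, ?_⟩
  · rw [hD]
    refine MeasurableSet.iInter fun n => MeasurableSet.iUnion fun q => MeasurableSet.iUnion
      fun m => (isClosed_frontier.inter (isClosed_biInter fun r hr => ?_)).measurableSet
    exact (hcont _ (fun x r => integrableOn_abs_sub_const (hfin x r) (hint x r) q) r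
      hr.1).preimage_isClosed_of_isClosed isClosed_frontier isClosed_Iic
  · have hex : ∀ x, ∃ a : ℝ, x ∈ traceExistsSet μ Ω u →
        Tendsto (fun r : ℝ => ⨍ y in Ω ∩ ball x r, |u y - a| ∂μ) (𝓝[>] 0) (𝓝 0) := fun x => by
      by_cases hx : x ∈ traceExistsSet μ Ω u
      · exact hx.2.imp fun a ha _ => ha
      · exact ⟨0, fun h => absurd h hx⟩
    choose T hT using hex
    refine ⟨T, hT, measurable_of_tendsto_metrizable
      (f := fun (n : ℕ) (p : traceExistsSet μ Ω u) =>
        ⨍ y in Ω ∩ ball (p : X) (1 / ((n : ℝ) + 1)), u y ∂μ) (fun n => ?_) ?_⟩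
    · exact ((hcont u hint _ Nat.one_div_pos_of_nat).comp_continuous continuous_subtype_val
        fun p => p.2.1).measurable
    · refine tendsto_pi_nhds.2 fun p => ?_
      have hseq : Tendsto (fun n : ℕ => 1 / ((n : ℝ) + 1)) atTop (𝓝[>] 0) :=
        tendsto_nhdsWithin_iff.2 ⟨tendsto_one_div_add_atTop_nhds_zero_nat,
          Eventually.of_forall fun n => mem_Ioi.2 Nat.one_div_pos_of_nat⟩
      refine tendsto_iff_dist_tendsto_zero.2 (squeeze_zero (fun n => dist_nonneg) (fun n => ?_)
        ((hT p p.2).comp hseq))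
      rw [Real.dist_eq]
      exact abs_setAverage_sub_le (hmass p p.2.1 _ Nat.one_div_pos_of_nat).ne' (hfin _ _)
        (hint _ _) _
end

section
/- Let Ω := B(0,1) \ {(x₁,x₂) ∈ ℝ² : x₁ > 0, x₂ = 0} be the open slit disk in ℝ², equipped with the Euclidean metric and 2-dimensional Lebesgue measure ℒ², and let u : Ω → ℝ be the argument function u(z) = Arg(z) with values in (0,2π). Then for every boundary point z = (x₁,0) with 0 < x₁ < 1 we have lim_{r→0+} (1/ℒ²(Ω∩B(z,r)))·∫_{Ω∩B(z,r)} u dℒ² = π, and yet there is no a ∈ ℝ with lim_{r→0+} (1/ℒ²(Ω∩B(z,r)))·∫_{Ω∩B(z,r)} |u − a| dℒ² = 0; in fact liminf_{r→0+} (1/ℒ²(Ω∩B(z,r)))·∫_{Ω∩B(z,r)} |u − a| dℒ² ≥ π/2 for every a ∈ ℝ. In particular, the trace of u fails to exist at every point of the slit. -/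
open Metric MeasureTheory Filter Topology Set Real

/-- The slit disk: the open unit disk in the plane (identified with `ℂ`) with the
positive real axis removed. -/
def slitDisk : Set ℂ := Metric.ball 0 1 \ {z : ℂ | 0 < z.re ∧ z.im = 0}

/-- The argument function with values in `(0, 2π)`: `Arg z` measured counterclockwise
from the positive real axis. -/
noncomputable def argZeroTwoPi (z : ℂ) : ℝ :=
  if 0 < Complex.arg z then Complex.arg z else Complex.arg z + 2 * π

theorem measurable_argZeroTwoPi : Measurable argZeroTwoPi :=
  Measurable.ite (measurableSet_lt measurable_const Complex.measurable_arg)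
    Complex.measurable_arg (Complex.measurable_arg.add_const _)

theorem abs_argZeroTwoPi_le (z : ℂ) : |argZeroTwoPi z| ≤ 2 * π := by
  have h₁ := Complex.neg_pi_lt_arg z
  have h₂ := Complex.arg_le_pi z
  rw [argZeroTwoPi, abs_le]
  split_ifs <;> constructor <;> linarith

theorem measurableSet_slitDisk : MeasurableSet slitDisk :=
  measurableSet_ball.diff <|
    (measurableSet_lt measurable_const Complex.measurable_re).inter
      (measurableSet_eq_fun Complex.measurable_im measurable_const)

theorem argZeroTwoPi_conj {z : ℂ} (hz : z.im ≠ 0) :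
    argZeroTwoPi (starRingEnd ℂ z) = 2 * π - argZeroTwoPi z := by
  have hpi : z.arg ≠ π := fun h => hz (Complex.arg_eq_pi_iff.1 h).2
  have h0 : z.arg ≠ 0 := fun h => hz (Complex.arg_eq_zero_iff.1 h).2
  rw [argZeroTwoPi, argZeroTwoPi, Complex.arg_conj, if_neg hpi]
  rcases h0.lt_or_gt with h | h
  · rw [if_pos (by linarith), if_neg (by linarith)]; ring
  · rw [if_neg (by linarith), if_pos h]; ring

theorem pi_div_two_le_abs_argZeroTwoPi_sub_pi {z : ℂ} (hz : 0 < z.re) :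
    π / 2 ≤ |argZeroTwoPi z - π| := by
  have h := abs_lt.1 (Complex.abs_arg_lt_pi_div_two_iff.2 (Or.inl hz))
  rw [argZeroTwoPi, le_abs]
  split_ifs with h0
  · right; linarith
  · left; linarith

theorem conj_preimage_slitDisk_inter_ball (x r : ℝ) :
    starRingEnd ℂ ⁻¹' (slitDisk ∩ ball (x : ℂ) r) = slitDisk ∩ ball (x : ℂ) r := by
  ext w
  have h : dist (starRingEnd ℂ w) (x : ℂ) = dist w x := by
    rw [← Complex.conj_ofReal x, Complex.dist_conj_conj, Complex.conj_ofReal]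
  simp only [slitDisk, mem_preimage, mem_inter_iff, Set.mem_sdiff, mem_ball, mem_ofPred_eq, h,
    Complex.conj_re, Complex.conj_im, neg_eq_zero, dist_zero_right, RCLike.norm_conj]

theorem setIntegral_conj_slitDisk_inter_ball (x r : ℝ) (f : ℂ → ℝ) :
    ∫ w in slitDisk ∩ ball (x : ℂ) r, f (starRingEnd ℂ w) =
      ∫ w in slitDisk ∩ ball (x : ℂ) r, f w := by
  have h := Complex.conjLIE.measurePreserving.setIntegral_preimage_emb
    Complex.conjLIE.toHomeomorph.measurableEmbedding f (slitDisk ∩ ball (x : ℂ) r)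
  have hpre : Complex.conjLIE ⁻¹' (slitDisk ∩ ball (x : ℂ) r) = slitDisk ∩ ball (x : ℂ) r :=
    conj_preimage_slitDisk_inter_ball x r
  rw [hpre] at h
  exact h

theorem volume_slitDisk_inter_ball_ne_top (x r : ℝ) :
    volume (slitDisk ∩ ball (x : ℂ) r) ≠ ⊤ :=
  ((measure_mono inter_subset_right).trans_lt measure_ball_lt_top).ne

theorem volume_slitDisk_inter_ball_ne_zero {x r : ℝ} (hr : 0 < r) (hrx : r < x)
    (hrx' : r < 1 - x) : volume (slitDisk ∩ ball (x : ℂ) r) ≠ 0 := by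
  have hsub : ball (x : ℂ) r ∩ {w : ℂ | 0 < w.im} ⊆ slitDisk ∩ ball (x : ℂ) r := by
    rintro w ⟨hw, him⟩
    refine ⟨⟨?_, fun h => him.ne' h.2⟩, hw⟩
    refine ball_subset_ball' ?_ hw
    rw [dist_zero_right, Complex.norm_real, Real.norm_of_nonneg (by linarith)]
    linarith
  have hopen : IsOpen (ball (x : ℂ) r ∩ {w : ℂ | 0 < w.im}) :=
    isOpen_ball.inter (isOpen_lt continuous_const Complex.continuous_im)
  refine fun h => (hopen.measure_pos volume ⟨⟨x, r / 2⟩, ?_, ?_⟩).ne' (measure_mono_null hsub h)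
  · have : (⟨x, r / 2⟩ : ℂ) - x = ((r / 2 : ℝ) : ℂ) * Complex.I := by
      apply Complex.ext <;> simp
    rw [mem_ball, dist_eq_norm, this, norm_mul, Complex.norm_I, Complex.norm_real,
      Real.norm_of_nonneg (by linarith)]
    linarith
  · exact half_pos hr

theorem re_pos_and_im_ne_zero_of_mem {x r : ℝ} (hrx : r < x) {w : ℂ}
    (hw : w ∈ slitDisk ∩ ball (x : ℂ) r) : 0 < w.re ∧ w.im ≠ 0 := by
  have h := (Complex.abs_re_le_norm (w - x)).trans_lt (mem_ball_iff_norm.1 hw.2)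
  rw [Complex.sub_re, Complex.ofReal_re, abs_lt] at h
  have hre : 0 < w.re := by linarith
  exact ⟨hre, fun him => hw.1.2 ⟨hre, him⟩⟩

theorem integrableOn_argZeroTwoPi (x r : ℝ) :
    IntegrableOn argZeroTwoPi (slitDisk ∩ ball (x : ℂ) r) :=
  IntegrableOn.of_bound (volume_slitDisk_inter_ball_ne_top x r).lt_top
    measurable_argZeroTwoPi.aestronglyMeasurable (2 * π)
    (ae_of_all _ abs_argZeroTwoPi_le)

theorem integrableOn_abs_argZeroTwoPi_sub (x r a : ℝ) :
    IntegrableOn (fun w => |argZeroTwoPi w - a|) (slitDisk ∩ ball (x : ℂ) r) :=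
  ((integrableOn_argZeroTwoPi x r).sub
    (integrableOn_const (volume_slitDisk_inter_ball_ne_top x r))).abs

theorem setAverage_argZeroTwoPi {x r : ℝ} (hr : 0 < r) (hrx : r < x) (hrx' : r < 1 - x) :
    ⨍ w in slitDisk ∩ ball (x : ℂ) r, argZeroTwoPi w = π := by
  have hm : MeasurableSet (slitDisk ∩ ball (x : ℂ) r) :=
    measurableSet_slitDisk.inter measurableSet_ball
  have htop := volume_slitDisk_inter_ball_ne_top x r
  have hpos : volume.real (slitDisk ∩ ball (x : ℂ) r) ≠ 0 :=
    (measureReal_ne_zero_iff htop).2 (volume_slitDisk_inter_ball_ne_zero hr hrx hrx')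
  have h := setIntegral_conj_slitDisk_inter_ball x r argZeroTwoPi
  rw [setIntegral_congr_fun hm fun w hw =>
      argZeroTwoPi_conj (re_pos_and_im_ne_zero_of_mem hrx hw).2,
    integral_sub (f := fun _ => 2 * π) (integrableOn_const htop)
      (integrableOn_argZeroTwoPi x r),
    setIntegral_const, smul_eq_mul] at h
  rw [setAverage_eq, smul_eq_mul, inv_mul_eq_iff_eq_mul₀ hpos]
  linarith

theorem pi_div_two_le_setAverage_abs_argZeroTwoPi_sub {x r : ℝ} (hr : 0 < r) (hrx : r < x)
    (hrx' : r < 1 - x) (a : ℝ) :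
    π / 2 ≤ ⨍ w in slitDisk ∩ ball (x : ℂ) r, |argZeroTwoPi w - a| := by
  have hm : MeasurableSet (slitDisk ∩ ball (x : ℂ) r) :=
    measurableSet_slitDisk.inter measurableSet_ball
  have htop := volume_slitDisk_inter_ball_ne_top x r
  have hpos : 0 < volume.real (slitDisk ∩ ball (x : ℂ) r) :=
    measureReal_nonneg.lt_of_ne'
      ((measureReal_ne_zero_iff htop).2 (volume_slitDisk_inter_ball_ne_zero hr hrx hrx'))
  have hrefl : ∫ w in slitDisk ∩ ball (x : ℂ) r, |argZeroTwoPi w - (2 * π - a)| =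
      ∫ w in slitDisk ∩ ball (x : ℂ) r, |argZeroTwoPi w - a| := by
    rw [← setIntegral_conj_slitDisk_inter_ball x r fun w => |argZeroTwoPi w - a|]
    refine setIntegral_congr_fun hm fun w hw => ?_
    simp only [argZeroTwoPi_conj (re_pos_and_im_ne_zero_of_mem hrx hw).2]
    rw [abs_sub_comm]
    ring_nf
  have hle : ∫ _ in slitDisk ∩ ball (x : ℂ) r, π ≤
      ∫ w in slitDisk ∩ ball (x : ℂ) r,
        (|argZeroTwoPi w - a| + |argZeroTwoPi w - (2 * π - a)|) := by
    refine setIntegral_mono_on (integrableOn_const htop)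
      ((integrableOn_abs_argZeroTwoPi_sub x r _).add
        (integrableOn_abs_argZeroTwoPi_sub x r _)) hm fun w hw => ?_
    have h := pi_div_two_le_abs_argZeroTwoPi_sub_pi (re_pos_and_im_ne_zero_of_mem hrx hw).1
    have h' := abs_add_le (argZeroTwoPi w - a) (argZeroTwoPi w - (2 * π - a))
    have h'' : argZeroTwoPi w - a + (argZeroTwoPi w - (2 * π - a)) =
        2 * (argZeroTwoPi w - π) := by ring
    rw [h'', abs_mul, abs_two] at h'
    linarith
  rw [integral_add (integrableOn_abs_argZeroTwoPi_sub x r _)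
    (integrableOn_abs_argZeroTwoPi_sub x r _), hrefl, setIntegral_const, smul_eq_mul] at hle
  rw [setAverage_eq, smul_eq_mul, le_inv_mul_iff₀ hpos]
  linarith

theorem setAverage_abs_argZeroTwoPi_sub_le {x r : ℝ} (hr : 0 < r) (hrx : r < x)
    (hrx' : r < 1 - x) (a : ℝ) :
    ⨍ w in slitDisk ∩ ball (x : ℂ) r, |argZeroTwoPi w - a| ≤ 2 * π + |a| := by
  have htop := volume_slitDisk_inter_ball_ne_top x r
  have hpos : 0 < volume.real (slitDisk ∩ ball (x : ℂ) r) :=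
    measureReal_nonneg.lt_of_ne'
      ((measureReal_ne_zero_iff htop).2 (volume_slitDisk_inter_ball_ne_zero hr hrx hrx'))
  have hle : ∫ w in slitDisk ∩ ball (x : ℂ) r, |argZeroTwoPi w - a| ≤
      ∫ _ in slitDisk ∩ ball (x : ℂ) r, (2 * π + |a|) :=
    setIntegral_mono (integrableOn_abs_argZeroTwoPi_sub x r a) (integrableOn_const htop)
      fun w => (abs_sub _ _).trans (by gcongr; exact abs_argZeroTwoPi_le w)
  rw [setIntegral_const, smul_eq_mul] at hle
  rwa [setAverage_eq, smul_eq_mul, inv_mul_le_iff₀ hpos]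

/-- On the slit disk `Ω`, the function `u = Arg` (with values in `(0,2π)`) satisfies, at
every point `z = (x₁, 0)` of the slit with `0 < x₁ < 1`:
the averages `⨍_{Ω∩B(z,r)} u dℒ²` converge to `π` as `r → 0⁺`, yet for every `a ∈ ℝ` we
have `liminf_{r→0⁺} ⨍_{Ω∩B(z,r)} |u − a| dℒ² ≥ π/2`; in particular no `a ∈ ℝ` satisfies
`lim_{r→0⁺} ⨍_{Ω∩B(z,r)} |u − a| dℒ² = 0`, i.e. the trace of `u` fails to exist at `z`. -/
theorem slit_disk_no_trace (x₁ : ℝ) (h0 : 0 < x₁) (h1 : x₁ < 1) :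
    Tendsto (fun r : ℝ => ⨍ w in slitDisk ∩ Metric.ball (x₁ : ℂ) r, argZeroTwoPi w)
      (𝓝[>] 0) (𝓝 π) ∧
    (∀ a : ℝ, π / 2 ≤
      liminf (fun r : ℝ => ⨍ w in slitDisk ∩ Metric.ball (x₁ : ℂ) r, |argZeroTwoPi w - a|)
        (𝓝[>] 0)) ∧
    ¬ ∃ a : ℝ,
      Tendsto (fun r : ℝ => ⨍ w in slitDisk ∩ Metric.ball (x₁ : ℂ) r, |argZeroTwoPi w - a|)
        (𝓝[>] 0) (𝓝 0) := by
  have hsmall : ∀ᶠ r : ℝ in 𝓝[>] 0, 0 < r ∧ r < x₁ ∧ r < 1 - x₁ := by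
    filter_upwards [self_mem_nhdsWithin, nhdsWithin_le_nhds (Iio_mem_nhds h0),
      nhdsWithin_le_nhds (Iio_mem_nhds (sub_pos.2 h1))] with r hr hrx hrx'
    exact ⟨hr, hrx, hrx'⟩
  have hlower (a : ℝ) : ∀ᶠ r : ℝ in 𝓝[>] 0,
      π / 2 ≤ ⨍ w in slitDisk ∩ Metric.ball (x₁ : ℂ) r, |argZeroTwoPi w - a| :=
    hsmall.mono fun r hr =>
      pi_div_two_le_setAverage_abs_argZeroTwoPi_sub hr.1 hr.2.1 hr.2.2 a
  refine ⟨?_, fun a => ?_, ?_⟩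
  · exact tendsto_const_nhds.congr' <|
      hsmall.mono fun r hr => (setAverage_argZeroTwoPi hr.1 hr.2.1 hr.2.2).symm
  · have hbdd : IsBoundedUnder (· ≤ ·) (𝓝[>] (0 : ℝ))
        fun r : ℝ => ⨍ w in slitDisk ∩ Metric.ball (x₁ : ℂ) r, |argZeroTwoPi w - a| :=
      isBoundedUnder_of_eventually_le <|
        hsmall.mono fun r hr => setAverage_abs_argZeroTwoPi_sub_le hr.1 hr.2.1 hr.2.2 a
    exact le_liminf_of_le hbdd.isCoboundedUnder_ge (hlower a)
  · rintro ⟨a, ha⟩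
    have := ge_of_tendsto ha (hlower a)
    linarith [pi_pos]
end

section
/- On ℝ² (with the Euclidean metric) define the weighted measure μ by dμ = |x|^{-1} dℒ², where ℒ² is the Lebesgue measure. Then μ(B(0,r)) = 2πr for every r > 0. Moreover, with Ω := {(x₁,x₂) ∈ ℝ² : 0 < x₁ < 1, |x₂| < x₁²}, one has μ(B(0,r)∩Ω) ≤ r² for every 0 < r ≤ 1. -/
open Metric MeasureTheory Filter Topology Set Real

/-- The weighted measure `dμ = |x|⁻¹ dℒ²` on the Euclidean plane. -/
noncomputable def weightedMeasure : Measure (EuclideanSpace ℝ (Fin 2)) :=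
  volume.withDensity fun x => ENNReal.ofReal ‖x‖⁻¹

/-- The exterior cusp domain `Ω = {(x₁,x₂) : 0 < x₁ < 1, |x₂| < x₁²}`. -/
def cuspDomain : Set (EuclideanSpace ℝ (Fin 2)) :=
  {x | 0 < x 0 ∧ x 0 < 1 ∧ |x 1| < (x 0) ^ 2}

/-- The coordinate map from the Euclidean plane to `ℝ × ℝ` preserves Lebesgue measure. -/
theorem measurePreserving_euclideanSpace_fin_two_coords :
    MeasurePreserving (fun x : EuclideanSpace ℝ (Fin 2) => (x 0, x 1)) :=
  (volume_preserving_finTwoArrow ℝ).comp (PiLp.volume_preserving_ofLp (Fin 2))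

theorem weightedMeasure_preimage_coords {A : Set (ℝ × ℝ)} (hA : MeasurableSet A) :
    weightedMeasure ((fun x : EuclideanSpace ℝ (Fin 2) => (x 0, x 1)) ⁻¹' A) =
      ∫⁻ p in A, ENNReal.ofReal (√(p.1 ^ 2 + p.2 ^ 2))⁻¹ := by
  have h := measurePreserving_euclideanSpace_fin_two_coords
  rw [weightedMeasure, withDensity_apply _ (h.measurable hA),
    ← h.setLIntegral_comp_preimage hA (by fun_prop)]
  simp [EuclideanSpace.norm_eq, Fin.sum_univ_two]

theorem weightedMeasure_ball_zero {r : ℝ} (hr : 0 < r) :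
    weightedMeasure (ball 0 r) = ENNReal.ofReal (2 * π * r) := by
  have hA : MeasurableSet {p : ℝ × ℝ | √(p.1 ^ 2 + p.2 ^ 2) < r} :=
    measurableSet_lt (by fun_prop) measurable_const
  have hball : (ball 0 r : Set (EuclideanSpace ℝ (Fin 2))) =
      (fun x : EuclideanSpace ℝ (Fin 2) => (x 0, x 1)) ⁻¹' {p | √(p.1 ^ 2 + p.2 ^ 2) < r} := by
    ext x
    simp [EuclideanSpace.norm_eq, Fin.sum_univ_two]
  rw [hball, weightedMeasure_preimage_coords hA, ← lintegral_indicator hA,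
    ← lintegral_comp_polarCoord_symm]
  have htarget : MeasurableSet polarCoord.target := polarCoord.open_target.measurableSet
  have hpolar : ∀ p ∈ polarCoord.target,
      ENNReal.ofReal p.1 • {p : ℝ × ℝ | √(p.1 ^ 2 + p.2 ^ 2) < r}.indicator
        (fun p => ENNReal.ofReal (√(p.1 ^ 2 + p.2 ^ 2))⁻¹) (polarCoord.symm p) =
      (Iio r ×ˢ univ).indicator 1 p := by
    rintro ⟨s, θ⟩ hp
    have hs : 0 < s := hp.1
    have hnorm : √((s * cos θ) ^ 2 + (s * sin θ) ^ 2) = s := by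
      rw [mul_pow, mul_pow, ← mul_add, cos_sq_add_sin_sq, mul_one, sqrt_sq hs.le]
    by_cases hsr : s < r
    · simp [indicator, hnorm, hsr, ← ENNReal.ofReal_mul hs.le, hs.ne']
    · simp [indicator, hnorm, hsr]
  have hset : Iio r ×ˢ univ ∩ polarCoord.target = Ioo 0 r ×ˢ Ioo (-π) π := by
    ext p
    simp only [polarCoord_target, mem_inter_iff, mem_prod, mem_Iio, mem_univ, mem_Ioi, mem_Ioo]
    tauto
  rw [setLIntegral_congr_fun htarget hpolar,
    lintegral_indicator_one (measurableSet_Iio.prod .univ),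
    Measure.restrict_apply (measurableSet_Iio.prod .univ), hset, Measure.volume_eq_prod,
    Measure.prod_prod, Real.volume_Ioo, Real.volume_Ioo, ← ENNReal.ofReal_mul (by linarith)]
  congr 1
  ring

theorem weightedMeasure_ball_inter_cuspDomain_le {r : ℝ} (hr : 0 < r) :
    weightedMeasure (ball 0 r ∩ cuspDomain) ≤ ENNReal.ofReal (r ^ 2) := by
  set A : Set (ℝ × ℝ) := regionBetween (fun t => -t ^ 2) (fun t => t ^ 2) (Ioo 0 r)
  have hA : MeasurableSet A :=
    measurableSet_regionBetween (by fun_prop) (by fun_prop) measurableSet_Ioo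
  have hsub : ball 0 r ∩ cuspDomain ⊆
      (fun x : EuclideanSpace ℝ (Fin 2) => (x 0, x 1)) ⁻¹' A := by
    rintro x ⟨hxr, hx0, -, hx⟩
    have hle := PiLp.norm_apply_le x 0
    rw [mem_ball_zero_iff] at hxr
    exact ⟨⟨hx0, ((le_abs_self _).trans hle).trans_lt hxr⟩, abs_lt.mp hx⟩
  calc weightedMeasure (ball 0 r ∩ cuspDomain)
      ≤ ∫⁻ p in A, ENNReal.ofReal (√(p.1 ^ 2 + p.2 ^ 2))⁻¹ :=
        (measure_mono hsub).trans_eq (weightedMeasure_preimage_coords hA)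
    _ ≤ ∫⁻ p in A, ENNReal.ofReal p.1⁻¹ := by
        refine setLIntegral_mono' hA fun p hp => ENNReal.ofReal_le_ofReal ?_
        exact inv_anti₀ hp.1.1 (le_sqrt_of_sq_le (le_add_of_nonneg_right (sq_nonneg _)))
    _ = ∫⁻ t, ∫⁻ u, A.indicator (fun p => ENNReal.ofReal p.1⁻¹) (t, u) := by
        rw [← lintegral_indicator hA, Measure.volume_eq_prod, lintegral_prod]
        exact (Measurable.indicator (by fun_prop) hA).aemeasurable
    _ = ∫⁻ t in Ioo 0 r, ENNReal.ofReal (2 * t) := by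
        rw [← lintegral_indicator measurableSet_Ioo]
        congr 1 with t
        by_cases ht : t ∈ Ioo 0 r
        · have hfun : (fun u => A.indicator (fun p => ENNReal.ofReal p.1⁻¹) (t, u)) =
              (Ioo (-t ^ 2) (t ^ 2)).indicator fun _ => ENNReal.ofReal t⁻¹ := by
            ext u
            simp only [indicator, A, regionBetween, mem_ofPred_eq, ht, true_and]
          rw [hfun, lintegral_indicator_const measurableSet_Ioo, Real.volume_Ioo,
            indicator_of_mem ht, ← ENNReal.ofReal_mul (inv_nonneg.mpr ht.1.le)]
          congr 1
          field_simp [ht.1.ne']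
          ring
        · have hnot : ∀ u, (t, u) ∉ A := fun u hu => ht hu.1
          simp [hnot, ht]
    _ = ENNReal.ofReal (r ^ 2) := by
        rw [← ofReal_integral_eq_lintegral_ofReal, ← integral_Ioc_eq_integral_Ioo,
          ← intervalIntegral.integral_of_le hr.le]
        · congr 1
          rw [intervalIntegral.integral_const_mul, integral_id]
          ring
        · exact (Continuous.integrableOn_Icc (by fun_prop)).mono_set Ioo_subset_Icc_self
        · filter_upwards [ae_restrict_mem measurableSet_Ioo] with t ht
          exact mul_nonneg zero_le_two ht.1.le

/-- For the weighted measure `dμ = |x|⁻¹ dℒ²` on `ℝ²` one has `μ(B(0,r)) = 2πr` for all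
`r > 0`, and for the exterior cusp domain `Ω` one has `μ(B(0,r) ∩ Ω) ≤ r²` for
`0 < r ≤ 1`. -/
theorem weighted_measure_ball_and_cusp :
    (∀ r : ℝ, 0 < r →
      weightedMeasure (Metric.ball 0 r) = ENNReal.ofReal (2 * π * r)) ∧
    (∀ r : ℝ, 0 < r → r ≤ 1 →
      weightedMeasure (Metric.ball 0 r ∩ cuspDomain) ≤ ENNReal.ofReal (r ^ 2)) :=
  ⟨fun _ hr => weightedMeasure_ball_zero hr,
    fun _ hr _ => weightedMeasure_ball_inter_cuspDomain_le hr⟩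
end

section
/- On ℝ² equip the weighted measure μ given by dμ = |x|^{-1} dℒ², let Ω := {(x₁,x₂) ∈ ℝ² : 0 < x₁ < 1, |x₂| < x₁²}, and let u(x) := |x|^{-1/2} for x ∈ Ω. Then ∫_Ω |u| dμ < ∞ and ∫_Ω |x|^{-3/2} dμ < ∞, yet lim_{r→0+} (1/μ(B(0,r)∩Ω))·∫_{B(0,r)∩Ω} u dμ = ∞. In particular there is no a ∈ ℝ with lim_{r→0+} (1/μ(B(0,r)∩Ω))·∫_{B(0,r)∩Ω} |u − a| dμ = 0, i.e. the trace of u fails to exist at the origin. -/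
open Metric MeasureTheory Filter Topology Set Real

theorem isOpen_cuspDomain : IsOpen cuspDomain := by
  have h0 : Continuous fun x : EuclideanSpace ℝ (Fin 2) => x 0 := by fun_prop
  have h1 : Continuous fun x : EuclideanSpace ℝ (Fin 2) => x 1 := by fun_prop
  exact (isOpen_lt continuous_const h0).inter
    ((isOpen_lt h0 continuous_const).inter (isOpen_lt h1.abs (h0.pow 2)))

theorem apply_zero_le_norm (x : EuclideanSpace ℝ (Fin 2)) : x 0 ≤ ‖x‖ :=
  (le_abs_self _).trans (PiLp.norm_apply_le x 0)

theorem norm_pos_of_mem_cuspDomain {x : EuclideanSpace ℝ (Fin 2)} (hx : x ∈ cuspDomain) :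
    0 < ‖x‖ :=
  hx.1.trans_le (apply_zero_le_norm x)

theorem norm_le_two_of_mem_cuspDomain {x : EuclideanSpace ℝ (Fin 2)} (hx : x ∈ cuspDomain) :
    ‖x‖ ≤ 2 := by
  obtain ⟨h0, h1, h2⟩ := hx
  have h3 : |x 1| ≤ 1 := by nlinarith
  rw [EuclideanSpace.norm_eq, Fin.sum_univ_two]
  refine Real.sqrt_le_iff.2 ⟨by norm_num, ?_⟩
  simp only [Real.norm_eq_abs, sq_abs]
  nlinarith [sq_abs (x 1), abs_nonneg (x 1)]

/-- Tonelli's theorem on the cusp domain for functions of the first coordinate. -/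
theorem setLIntegral_cuspDomain {f : ℝ → ENNReal} (hf : Measurable f) :
    ∫⁻ x in cuspDomain, f (x 0) =
      ∫⁻ t in Ioo (0 : ℝ) 1, f t * ENNReal.ofReal (2 * t ^ 2) := by
  have he : MeasurePreserving fun x : EuclideanSpace ℝ (Fin 2) => (x 0, x 1) :=
    (volume_preserving_finTwoArrow ℝ).comp
      (EuclideanSpace.volume_preserving_symm_measurableEquiv_toLp (Fin 2))
  let S : Set (ℝ × ℝ) := {p | 0 < p.1 ∧ p.1 < 1 ∧ |p.2| < p.1 ^ 2}
  have hS : MeasurableSet S :=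
    ((isOpen_lt continuous_const continuous_fst).inter
      ((isOpen_lt continuous_fst continuous_const).inter
        (isOpen_lt continuous_snd.abs (continuous_fst.pow 2)))).measurableSet
  have hslice (t : ℝ) (ht : t ∈ Ioo (0 : ℝ) 1) :
      Prod.mk t ⁻¹' S = Ioo (-t ^ 2) (t ^ 2) := by
    ext y
    simp [S, ht.1, ht.2, abs_lt]
  have hslice_empty (t : ℝ) (ht : t ∉ Ioo (0 : ℝ) 1) : Prod.mk t ⁻¹' S = ∅ :=
    eq_empty_of_forall_notMem fun y hy => ht ⟨hy.1, hy.2.1⟩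
  calc ∫⁻ x in cuspDomain, f (x 0) = ∫⁻ p in S, f p.1 :=
        he.setLIntegral_comp_preimage hS (hf.comp measurable_fst)
    _ = ∫⁻ t, ∫⁻ y, S.indicator (fun p => f p.1) (t, y) := by
        rw [← lintegral_indicator hS, Measure.volume_eq_prod]
        exact lintegral_prod _ ((hf.comp measurable_fst).indicator hS).aemeasurable
    _ = ∫⁻ t, f t * volume (Prod.mk t ⁻¹' S) := by
        refine lintegral_congr fun t => ?_
        rw [← lintegral_indicator_const (measurable_prodMk_left hS)]
        rfl
    _ = ∫⁻ t, (Ioo (0 : ℝ) 1).indicator (fun t => f t * ENNReal.ofReal (2 * t ^ 2)) t := by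
        refine lintegral_congr fun t => ?_
        by_cases ht : t ∈ Ioo (0 : ℝ) 1
        · rw [hslice t ht, Real.volume_Ioo, indicator_of_mem ht]
          ring_nf
        · rw [hslice_empty t ht, measure_empty, mul_zero, indicator_of_notMem ht]
    _ = ∫⁻ t in Ioo (0 : ℝ) 1, f t * ENNReal.ofReal (2 * t ^ 2) :=
        lintegral_indicator measurableSet_Ioo _

theorem setLIntegral_norm_rpow_lt_top :
    ∫⁻ x in cuspDomain, ENNReal.ofReal (‖x‖ ^ (-(3 : ℝ) / 2)) ∂weightedMeasure < ⊤ := by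
  have hle : ∫⁻ x in cuspDomain, ENNReal.ofReal (‖x‖ ^ (-(3 : ℝ) / 2)) ∂weightedMeasure ≤
      ∫⁻ x in cuspDomain, ENNReal.ofReal (x 0 ^ (-(5 : ℝ) / 2)) := by
    rw [weightedMeasure, setLIntegral_withDensity_eq_setLIntegral_mul _ (by fun_prop)
      (by fun_prop) isOpen_cuspDomain.measurableSet]
    refine setLIntegral_mono' isOpen_cuspDomain.measurableSet fun x hx => ?_
    have hpos := norm_pos_of_mem_cuspDomain hx
    rw [Pi.mul_apply, ← ENNReal.ofReal_mul (by positivity), ← Real.rpow_neg_one,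
      ← Real.rpow_add hpos]
    refine ENNReal.ofReal_le_ofReal ?_
    norm_num
    exact Real.rpow_le_rpow_of_nonpos hx.1 (apply_zero_le_norm x) (by norm_num)
  refine hle.trans_lt ?_
  rw [setLIntegral_cuspDomain (f := fun t => ENNReal.ofReal (t ^ (-(5 : ℝ) / 2)))
    (by fun_prop)]
  have hint : IntegrableOn (fun t : ℝ => 2 * t ^ (-(1 : ℝ) / 2)) (Ioo 0 1) :=
    ((intervalIntegral.integrableOn_Ioo_rpow_iff one_pos).2 (by norm_num)).const_mul 2
  refine (setLIntegral_mono' measurableSet_Ioo fun t ht => ?_).trans_lt hint.lintegral_lt_top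
  rw [← ENNReal.ofReal_mul (Real.rpow_nonneg ht.1.le _), mul_left_comm, ← Real.rpow_natCast,
    ← Real.rpow_add ht.1]
  norm_num

theorem integrableOn_norm_rpow :
    IntegrableOn (fun x => ‖x‖ ^ (-(3 : ℝ) / 2)) cuspDomain weightedMeasure :=
  ⟨(measurable_norm.pow_const _).aestronglyMeasurable, by
    rw [hasFiniteIntegral_iff_ofReal (ae_of_all _ fun x => by positivity)]
    exact setLIntegral_norm_rpow_lt_top⟩

/-- Powers with a larger exponent are integrable too, as the cusp domain is bounded. -/
theorem integrableOn_norm_rpow_of_le {p : ℝ} (hp : -(3 : ℝ) / 2 ≤ p) :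
    IntegrableOn (fun x => ‖x‖ ^ p) cuspDomain weightedMeasure := by
  refine Integrable.mono' (integrableOn_norm_rpow.const_mul (2 ^ (p + 3 / 2)))
    (measurable_norm.pow_const _).aestronglyMeasurable ?_
  refine ae_restrict_of_forall_mem isOpen_cuspDomain.measurableSet fun x hx => ?_
  have hpos := norm_pos_of_mem_cuspDomain hx
  rw [Real.norm_of_nonneg (by positivity)]
  calc ‖x‖ ^ p = ‖x‖ ^ (p + 3 / 2) * ‖x‖ ^ (-(3 : ℝ) / 2) := by
        rw [← Real.rpow_add hpos]; congr 1; ring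
    _ ≤ 2 ^ (p + 3 / 2) * ‖x‖ ^ (-(3 : ℝ) / 2) := by
        gcongr
        · linarith
        · exact norm_le_two_of_mem_cuspDomain hx

theorem weightedMeasure_cuspDomain_lt_top : weightedMeasure cuspDomain < ⊤ := by
  have h := integrableOn_norm_rpow_of_le (p := 0) (by norm_num)
  simp only [Real.rpow_zero] at h
  simpa using (integrableOn_const_iff (C := (1 : ℝ))).1 h

theorem weightedMeasure_ball_inter_cuspDomain_ne_zero {r : ℝ} (hr : 0 < r) :
    weightedMeasure (ball 0 r ∩ cuspDomain) ≠ 0 := by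
  have hopen : IsOpen (ball 0 r ∩ cuspDomain) := isOpen_ball.inter isOpen_cuspDomain
  have hne : (ball 0 r ∩ cuspDomain).Nonempty := by
    have h : 0 < min r 1 / 2 := by positivity
    have h1 := min_le_left r 1
    have h2 := min_le_right r 1
    refine ⟨EuclideanSpace.single 0 (min r 1 / 2), ?_, ?_, ?_, ?_⟩
    · rw [mem_ball_zero_iff, PiLp.norm_single, Real.norm_of_nonneg h.le]
      linarith
    · simpa using h
    · simp; linarith
    · simp; positivity
  intro h0
  rw [weightedMeasure, withDensity_apply_eq_zero (by fun_prop)] at h0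
  refine (hopen.measure_pos volume hne).ne' (measure_mono_null (subset_inter ?_ subset_rfl) h0)
  intro x hx
  simpa using norm_pos_iff.1 (norm_pos_of_mem_cuspDomain hx.2)

theorem le_setAverage_of_forall_le {α : Type*} [MeasurableSpace α] {μ : Measure α} {s : Set α}
    {f : α → ℝ} {c : ℝ} (hs : MeasurableSet s) (h0 : μ s ≠ 0) (htop : μ s ≠ ⊤)
    (hf : IntegrableOn f s μ) (hc : ∀ x ∈ s, c ≤ f x) : c ≤ ⨍ x in s, f x ∂μ := by
  rw [← setAverage_const h0 htop c]
  rw [setAverage_eq, setAverage_eq, smul_eq_mul, smul_eq_mul]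
  exact mul_le_mul_of_nonneg_left
    (setIntegral_mono_on (integrableOn_const htop) hf hs hc) (by positivity)

theorem le_setAverage_ball_inter_cuspDomain (a : ℝ) {r : ℝ} (hr : 0 < r) {f : EuclideanSpace ℝ (Fin 2) → ℝ}
    (hf : IntegrableOn f cuspDomain weightedMeasure)
    (h : ∀ x ∈ cuspDomain, ‖x‖ ^ (-(1 : ℝ) / 2) - a ≤ f x) :
    r ^ (-(1 : ℝ) / 2) - a ≤ ⨍ x in ball 0 r ∩ cuspDomain, f x ∂weightedMeasure := by
  refine le_setAverage_of_forall_le (isOpen_ball.inter isOpen_cuspDomain).measurableSet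
    (weightedMeasure_ball_inter_cuspDomain_ne_zero hr)
    ((measure_mono inter_subset_right).trans_lt weightedMeasure_cuspDomain_lt_top).ne
    (hf.mono_set inter_subset_right) fun x hx => le_trans ?_ (h x hx.2)
  gcongr ?_ - a
  exact Real.rpow_le_rpow_of_nonpos (norm_pos_of_mem_cuspDomain hx.2)
    (mem_ball_zero_iff.1 hx.1).le (by norm_num)

/-- A function dominating `‖x‖ ^ (-1/2) - a` has averages that blow up at the cusp. -/
theorem tendsto_setAverage_atTop (a : ℝ) {f : EuclideanSpace ℝ (Fin 2) → ℝ}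
    (hf : IntegrableOn f cuspDomain weightedMeasure)
    (h : ∀ x ∈ cuspDomain, ‖x‖ ^ (-(1 : ℝ) / 2) - a ≤ f x) :
    Tendsto (fun r : ℝ => ⨍ x in ball 0 r ∩ cuspDomain, f x ∂weightedMeasure)
      (𝓝[>] 0) atTop := by
  have hlim : Tendsto (fun r : ℝ => r ^ (-(1 : ℝ) / 2) - a) (𝓝[>] 0) atTop :=
    tendsto_atTop_add_const_right _ (-a) (tendsto_rpow_neg_nhdsGT_zero (by norm_num))
  refine tendsto_atTop_mono' _ ?_ hlim
  filter_upwards [self_mem_nhdsWithin] with r hr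
  exact le_setAverage_ball_inter_cuspDomain a hr hf h

/-- For the weighted measure `dμ = |x|⁻¹dℒ²` on `ℝ²`, the cusp domain `Ω` and
`u(x) = |x|^{-1/2}`: `u` is `μ`-integrable on `Ω` and `∫_Ω |x|^{-3/2} dμ < ∞`, yet the
averages of `u` over `B(0,r) ∩ Ω` blow up as `r → 0⁺`; in particular no real number `a`
satisfies `lim_{r→0⁺} ⨍_{B(0,r)∩Ω} |u − a| dμ = 0`, i.e. the trace of `u` fails to exist
at the origin. -/
theorem cusp_trace_fails_at_origin :
    (∫⁻ x in cuspDomain, ENNReal.ofReal (‖x‖ ^ (-(1 : ℝ) / 2)) ∂weightedMeasure) < ⊤ ∧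
    (∫⁻ x in cuspDomain, ENNReal.ofReal (‖x‖ ^ (-(3 : ℝ) / 2)) ∂weightedMeasure) < ⊤ ∧
    Tendsto (fun r : ℝ =>
        ⨍ x in Metric.ball 0 r ∩ cuspDomain, ‖x‖ ^ (-(1 : ℝ) / 2) ∂weightedMeasure)
      (𝓝[>] 0) atTop ∧
    ∀ a : ℝ, ¬ Tendsto (fun r : ℝ =>
        ⨍ x in Metric.ball 0 r ∩ cuspDomain, |‖x‖ ^ (-(1 : ℝ) / 2) - a| ∂weightedMeasure)
      (𝓝[>] 0) (𝓝 0) := by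
  have hint : IntegrableOn (fun x => ‖x‖ ^ (-(1 : ℝ) / 2)) cuspDomain weightedMeasure :=
    integrableOn_norm_rpow_of_le (by norm_num)
  refine ⟨hint.lintegral_lt_top, setLIntegral_norm_rpow_lt_top,
    tendsto_setAverage_atTop 0 hint fun x _ => (sub_zero _).le, fun a => ?_⟩
  have hconst : IntegrableOn (fun _ => a) cuspDomain weightedMeasure :=
    integrableOn_const weightedMeasure_cuspDomain_lt_top.ne
  exact not_tendsto_nhds_of_tendsto_atTop
    (tendsto_setAverage_atTop a (hint.sub hconst).abs fun x _ => le_abs_self _) 0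
end

section
/- Let Ω := {(x₁,x₂) ∈ ℝ² : 0 < x₁ < 1, |x₂| < x₁²} be the planar exterior-cusp domain, equipped with the Euclidean metric and the restriction of the Lebesgue measure ℒ². Then the restricted measure is doubling on Ω: there exists a constant C ≥ 1 such that ℒ²(B(x,2r)∩Ω) ≤ C·ℒ²(B(x,r)∩Ω) for every x ∈ Ω and every r > 0. -/
open Metric MeasureTheory Filter Topology Set ENNReal

/-- Membership in a planar Euclidean ball in coordinates. -/
lemma mem_ball_euclidean_fin_two {x y : EuclideanSpace ℝ (Fin 2)} {r : ℝ} (hr : 0 < r) :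
    y ∈ Metric.ball x r ↔ (y 0 - x 0) ^ 2 + (y 1 - x 1) ^ 2 < r ^ 2 := by
  rw [Metric.mem_ball, EuclideanSpace.dist_eq, Real.sqrt_lt' hr, Fin.sum_univ_two,
    Real.dist_eq, Real.dist_eq, sq_abs, sq_abs]

/-- Tonelli's theorem for measurable subsets of the Euclidean plane. -/
lemma volume_eq_lintegral_volume_slice {A : Set (EuclideanSpace ℝ (Fin 2))}
    (hA : MeasurableSet A) :
    volume A = ∫⁻ s : ℝ, volume {u : ℝ | !₂[s, u] ∈ A} := by
  have h1 := (EuclideanSpace.volume_preserving_symm_measurableEquiv_toLp (Fin 2)).symm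
  have h2 := (volume_preserving_finTwoArrow ℝ).symm
  have h := h1.comp h2
  rw [← h.measure_preimage hA.nullMeasurableSet, Measure.volume_eq_prod,
    Measure.prod_apply (h.measurable hA)]
  rfl

lemma measurableSet_cuspDomain : MeasurableSet cuspDomain := by
  have h0 : Measurable fun x : EuclideanSpace ℝ (Fin 2) => x 0 := by fun_prop
  have h1 : Measurable fun x : EuclideanSpace ℝ (Fin 2) => x 1 := by fun_prop
  have hpos := measurableSet_lt (measurable_const (a := (0 : ℝ))) h0
  have hlt := measurableSet_lt h0 (measurable_const (a := (1 : ℝ)))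
  have habs := measurableSet_lt (measurable_norm.comp h1) (h0.pow_const 2)
  exact hpos.inter (hlt.inter habs)

/-- In the coordinates `(s, t) ↦ (s, s ^ 2 * t)` of the cusp, the contraction with ratio `1 / 32`
towards a point maps the ball of radius `2 * r` around it into the ball of radius `r`. -/
lemma cusp_contraction_dist_lt {a c s t r : ℝ} (ha : 0 < a) (ha1 : a < 1) (hc : |c| < 1)
    (hs : 0 < s) (hs1 : s < 1) (ht : |t| < 1) (hr : 0 < r)
    (h : (s - a) ^ 2 + (s ^ 2 * t - a ^ 2 * c) ^ 2 < (2 * r) ^ 2) :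
    ((31 / 32 * a + 1 / 32 * s) - a) ^ 2 +
      ((31 / 32 * a + 1 / 32 * s) ^ 2 * (31 / 32 * c + 1 / 32 * t) - a ^ 2 * c) ^ 2 < r ^ 2 := by
  have hsa : |s - a| < 2 * r := abs_lt_of_sq_lt_sq (by nlinarith [sq_nonneg (s ^ 2 * t - a ^ 2 * c)])
    (by positivity)
  have hv : |s ^ 2 * t - a ^ 2 * c| < 2 * r :=
    abs_lt_of_sq_lt_sq (by nlinarith [sq_nonneg (s - a)]) (by positivity)
  set p := 31 / 32 * a + 1 / 32 * s with hp
  have hp0 : 0 < p := by positivity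
  have hp1 : p < 1 := by linarith
  have hpa : |p - a| ≤ r / 16 := by
    rw [show p - a = 1 / 32 * (s - a) by rw [hp]; ring, abs_mul, abs_of_pos (by norm_num)]
    linarith
  have hprod : ∀ q, 0 < q → q < 1 → |c * (q ^ 2 - a ^ 2)| ≤ 2 * |q - a| := by
    intro q hq hq1
    rw [show c * (q ^ 2 - a ^ 2) = (c * (q + a)) * (q - a) by ring, abs_mul]
    refine mul_le_mul_of_nonneg_right ?_ (abs_nonneg _)
    rw [abs_mul, abs_of_pos (by linarith : 0 < q + a)]
    nlinarith [abs_nonneg c]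
  have htc : |t - c| ≤ 2 := (abs_sub _ _).trans (by linarith)
  have hmain : p ^ 2 * |t - c| ≤ 24 * r := by
    rcases le_or_gt (a / 2) s with hsa2 | hsa2
    · have h6 : s ^ 2 * |t - c| ≤ 6 * r := by
        have e : s ^ 2 * |t - c| = |(s ^ 2 * t - a ^ 2 * c) - c * (s ^ 2 - a ^ 2)| := by
          rw [← abs_of_pos (pow_pos hs 2), ← abs_mul, abs_of_pos (pow_pos hs 2)]
          congr 1; ring
        rw [e]
        refine (abs_sub _ _).trans ?_
        linarith [hprod s hs hs1]
      have hps : p ^ 2 ≤ 4 * s ^ 2 := by nlinarith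
      nlinarith [mul_le_mul_of_nonneg_right hps (abs_nonneg (t - c))]
    · have : a < 4 * r := by linarith [(abs_lt.1 hsa).1]
      have hpa' : p ≤ a := by linarith
      have : p ^ 2 * |t - c| ≤ p * 2 := mul_le_mul (by nlinarith) htc (abs_nonneg _) hp0.le
      linarith
  have hvert : |p ^ 2 * (31 / 32 * c + 1 / 32 * t) - a ^ 2 * c| ≤ 7 / 8 * r := by
    rw [show p ^ 2 * (31 / 32 * c + 1 / 32 * t) - a ^ 2 * c =
      1 / 32 * (p ^ 2 * (t - c)) + c * (p ^ 2 - a ^ 2) by ring]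
    refine (abs_add_le _ _).trans ?_
    rw [abs_mul, abs_mul, abs_of_pos (by norm_num : (0 : ℝ) < 1 / 32), abs_of_pos (pow_pos hp0 2)]
    linarith [hprod p hp0 hp1]
  have e1 := sq_le_sq' (abs_le.1 hpa).1 (abs_le.1 hpa).2
  have e2 := sq_le_sq' (abs_le.1 hvert).1 (abs_le.1 hvert).2
  nlinarith [pow_pos hr 2]

/-- Vertical slices of `B(x,2r) ∩ Ω` are controlled by those of `B(x,r) ∩ Ω`. -/
lemma volume_cusp_slice_le {x : EuclideanSpace ℝ (Fin 2)} (hx : x ∈ cuspDomain) {r : ℝ}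
    (hr : 0 < r) (s : ℝ) :
    volume {u : ℝ | !₂[s, u] ∈ Metric.ball x (2 * r) ∩ cuspDomain} ≤
      ENNReal.ofReal (32 ^ 3) * volume {u : ℝ |
        !₂[31 / 32 * x 0 + 1 / 32 * s, u] ∈ Metric.ball x r ∩ cuspDomain} := by
  obtain ⟨ha, ha1, hb⟩ : 0 < x 0 ∧ x 0 < 1 ∧ |x 1| < (x 0) ^ 2 := hx
  by_cases hs : 0 < s ∧ s < 1
  swap
  · have : {u : ℝ | !₂[s, u] ∈ Metric.ball x (2 * r) ∩ cuspDomain} = ∅ := by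
      ext u
      simp only [mem_ofPred_eq, mem_empty_iff_false, iff_false]
      rintro ⟨-, h0, h1, -⟩
      exact hs ⟨h0, h1⟩
    rw [this, measure_empty]
    exact zero_le
  obtain ⟨hs, hs1⟩ := hs
  set a := x 0
  set p := 31 / 32 * a + 1 / 32 * s with hp
  have hp0 : 0 < p := by positivity
  set c := x 1 / a ^ 2 with hc
  have hxc : x 1 = a ^ 2 * c := by rw [hc]; field_simp
  have hc1 : |c| < 1 := by
    rw [hc, abs_div, abs_of_pos (pow_pos ha 2), div_lt_one (pow_pos ha 2)]; exact hb
  set k := 1 / 32 * (p ^ 2 / s ^ 2) with hk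
  have hk0 : 0 < k := by positivity
  have hk3 : 1 ≤ 32 ^ 3 * k := by
    have : (1 / 32) ^ 2 ≤ p ^ 2 / s ^ 2 := by
      rw [le_div_iff₀ (pow_pos hs 2), ← mul_pow]
      exact pow_le_pow_left₀ (by positivity) (by linarith) 2
    rw [hk]; linarith
  have hsub : {u : ℝ | !₂[s, u] ∈ Metric.ball x (2 * r) ∩ cuspDomain} ⊆
      (fun u => k * u) ⁻¹' ((fun u => u + p ^ 2 * (31 / 32 * c)) ⁻¹'
        {u : ℝ | !₂[p, u] ∈ Metric.ball x r ∩ cuspDomain}) := by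
    rintro u ⟨hball, -, -, hu⟩
    rw [mem_ball_euclidean_fin_two (by positivity)] at hball
    simp only [Matrix.cons_val_zero, Matrix.cons_val_one] at hball hu
    have hut : u = s ^ 2 * (u / s ^ 2) := by field_simp
    have ht : |u / s ^ 2| < 1 := by
      rw [abs_div, abs_of_pos (pow_pos hs 2), div_lt_one (pow_pos hs 2)]; exact hu
    have e : k * u + p ^ 2 * (31 / 32 * c) = p ^ 2 * (31 / 32 * c + 1 / 32 * (u / s ^ 2)) := by
      rw [hk]; ring
    simp only [mem_preimage, mem_ofPred_eq, e]
    refine ⟨?_, hp0, ?_, ?_⟩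
    · rw [mem_ball_euclidean_fin_two hr]
      simp only [Matrix.cons_val_zero, Matrix.cons_val_one]
      rw [hxc]
      rw [hut, hxc] at hball
      exact cusp_contraction_dist_lt ha ha1 hc1 hs hs1 ht hr hball
    · simp only [Matrix.cons_val_zero]
      linarith
    · simp only [Matrix.cons_val_zero, Matrix.cons_val_one]
      rw [abs_mul, abs_of_pos (pow_pos hp0 2)]
      refine mul_lt_of_lt_one_right (pow_pos hp0 2) ?_
      rw [abs_lt] at hc1 ht ⊢
      constructor <;> linarith
  refine (measure_mono hsub).trans ?_
  rw [Real.volume_preimage_mul_left hk0.ne', measure_preimage_add_right]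
  gcongr
  rw [abs_of_pos (inv_pos.2 hk0), inv_le_iff_one_le_mul₀ hk0]
  exact hk3

/-- Affine change of variables for the Lebesgue integral on the line. -/
lemma lintegral_comp_add_mul (f : ℝ → ℝ≥0∞) (b : ℝ) {k : ℝ} (hk : k ≠ 0) :
    ∫⁻ s, f (b + k * s) = ENNReal.ofReal |k⁻¹| * ∫⁻ s, f s := by
  have h := (Homeomorph.mulLeft₀ k hk).measurableEmbedding.lintegral_map (μ := volume)
    (fun s => f (b + s))
  simp only [Homeomorph.coe_mulLeft₀] at h
  rw [← h, Real.map_volume_mul_left hk, lintegral_smul_measure, lintegral_add_left_eq_self,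
    smul_eq_mul]

/-- The restriction of the Lebesgue measure `ℒ²` to the exterior cusp domain `Ω` is
doubling on `Ω`: there is a constant `C ≥ 1` such that
`ℒ²(B(x,2r) ∩ Ω) ≤ C·ℒ²(B(x,r) ∩ Ω)` for every `x ∈ Ω` and `r > 0`. -/
theorem cusp_measure_doubling :
    ∃ C : ℝ≥0∞, 1 ≤ C ∧ C ≠ ⊤ ∧ ∀ x ∈ cuspDomain, ∀ r : ℝ, 0 < r →
      volume (Metric.ball x (2 * r) ∩ cuspDomain) ≤
        C * volume (Metric.ball x r ∩ cuspDomain) := by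
  refine ⟨ENNReal.ofReal (32 ^ 3) * ENNReal.ofReal |(1 / 32 : ℝ)⁻¹|, ?_, by finiteness, ?_⟩
  · rw [← ENNReal.ofReal_mul (by positivity), ENNReal.one_le_ofReal]
    norm_num
  intro x hx r hr
  have hmeas : ∀ ρ : ℝ, MeasurableSet (Metric.ball x ρ ∩ cuspDomain) := fun ρ =>
    measurableSet_ball.inter measurableSet_cuspDomain
  rw [volume_eq_lintegral_volume_slice (hmeas _), volume_eq_lintegral_volume_slice (hmeas _)]
  refine (lintegral_mono (volume_cusp_slice_le hx hr)).trans ?_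
  rw [lintegral_const_mul' _ _ ENNReal.ofReal_ne_top, mul_assoc]
  exact (congrArg _ (lintegral_comp_add_mul
    (fun s => volume {u : ℝ | !₂[s, u] ∈ Metric.ball x r ∩ cuspDomain}) (31 / 32 * x 0)
    (by norm_num : (1 / 32 : ℝ) ≠ 0))).le
end

section
/- Let Ω := {(x₁,x₂) ∈ ℝ² : 0 < x₁ < 1, |x₂| < x₁²} with the Euclidean metric and Lebesgue measure ℒ². There exists a constant c > 0 such that for every x = (x₁,0) ∈ Ω and every z = (z₁,z₂) ∈ Ω with x₁ ≤ z₁, one has |z − x| / ℒ²(B(x,|z−x|)∩Ω) ≥ c / z₁². -/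
open Metric MeasureTheory Filter Topology Set ENNReal

/-- The Euclidean volume of a set of the plane contained in a coordinate rectangle is at most
the product of the side lengths. -/
theorem volume_le_of_forall_mem_Icc {s : Set (EuclideanSpace ℝ (Fin 2))} {a b : Fin 2 → ℝ}
    (hab : a ≤ b) (h : ∀ w ∈ s, ∀ i, w i ∈ Set.Icc (a i) (b i)) :
    volume s ≤ ENNReal.ofReal ((b 0 - a 0) * (b 1 - a 1)) := by
  have hs : s ⊆ (WithLp.ofLp : EuclideanSpace ℝ (Fin 2) → Fin 2 → ℝ) ⁻¹' Set.Icc a b :=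
    fun w hw => ⟨fun i => (h w hw i).1, fun i => (h w hw i).2⟩
  refine (measure_mono hs).trans ?_
  rw [(PiLp.volume_preserving_ofLp (Fin 2)).measure_preimage
    measurableSet_Icc.nullMeasurableSet, Real.volume_Icc_pi, Fin.prod_univ_two,
    ENNReal.ofReal_mul (sub_nonneg.2 (hab 0))]

/-- The distance in the plane is at most the sum of the coordinate distances. -/
theorem dist_le_abs_add_abs (z x : EuclideanSpace ℝ (Fin 2)) :
    dist z x ≤ |z 0 - x 0| + |z 1 - x 1| := by
  rw [EuclideanSpace.dist_eq, Fin.sum_univ_two, Real.dist_eq, Real.dist_eq]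
  refine Real.sqrt_le_iff.2 ⟨by positivity, ?_⟩
  nlinarith [mul_nonneg (abs_nonneg (z 0 - x 0)) (abs_nonneg (z 1 - x 1))]

/-- Riesz kernel estimate in the cusp domain: there is `c > 0` such that for every
`x = (x₁, 0) ∈ Ω` and every `z = (z₁, z₂) ∈ Ω` with `x₁ ≤ z₁` (and `z ≠ x`, so that the
kernel is defined), one has `|z − x| / ℒ²(B(x,|z−x|) ∩ Ω) ≥ c / z₁²`. -/
theorem cusp_riesz_kernel_estimate :
    ∃ c : ℝ, 0 < c ∧ ∀ x ∈ cuspDomain, x 1 = 0 →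
      ∀ z ∈ cuspDomain, x 0 ≤ z 0 → z ≠ x →
        ENNReal.ofReal (c / (z 0) ^ 2) ≤
          ENNReal.ofReal (dist z x) / volume (Metric.ball x (dist z x) ∩ cuspDomain) := by
  refine ⟨1 / 36, by norm_num, ?_⟩
  rintro x ⟨hx0, -, -⟩ hx z ⟨hz0, hz1, hz2⟩ hxz hne
  have hr : 0 < dist z x := dist_pos.2 hne
  have hr2 : dist z x ≤ 2 * z 0 := by
    have h := dist_le_abs_add_abs z x
    rw [hx, sub_zero, abs_of_nonneg (sub_nonneg.2 hxz)] at h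
    nlinarith
  set r := dist z x
  have hvol : volume (Metric.ball x r ∩ cuspDomain) ≤ ENNReal.ofReal (36 * r * z 0 ^ 2) := by
    have hbox := volume_le_of_forall_mem_Icc (s := Metric.ball x r ∩ cuspDomain)
      (a := ![x 0 - r, -(9 * z 0 ^ 2)]) (b := ![x 0 + r, 9 * z 0 ^ 2]) ?_ ?_
    · refine hbox.trans (ENNReal.ofReal_le_ofReal (le_of_eq ?_))
      simp only [Matrix.cons_val_zero, Matrix.cons_val_one]
      ring
    · intro i
      fin_cases i
      · simp; linarith
      · simp; nlinarith [sq_nonneg (z 0)]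
    · rintro w ⟨hw, hw0, -, hw2⟩ i
      have h0 : |w 0 - x 0| < r := by
        have h := PiLp.norm_apply_le (w - x) 0
        rw [← dist_eq_norm] at h
        exact lt_of_le_of_lt h hw
      rw [abs_lt] at h0
      have h1 : w 0 ^ 2 ≤ 9 * z 0 ^ 2 := by nlinarith
      rw [abs_lt] at hw2
      fin_cases i
      · exact ⟨by simp; linarith, by simp; linarith⟩
      · exact ⟨by simp; linarith, by simp; linarith⟩
  calc ENNReal.ofReal (1 / 36 / z 0 ^ 2)
      = ENNReal.ofReal (r / (36 * r * z 0 ^ 2)) := by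
        congr 1
        field_simp
    _ = ENNReal.ofReal r / ENNReal.ofReal (36 * r * z 0 ^ 2) :=
        ENNReal.ofReal_div_of_pos (by positivity)
    _ ≤ _ := ENNReal.div_le_div_left hvol _
end

section
/- Fix 0 < x₁ < 1 and define Φ : (−1,1) × (0,1−x₁) → ℝ² by Φ(s,t) := (x₁ + t, s·(x₁ + t)²). Then for every Borel set A ⊂ ℝ², ∫_{(−1,1)×(0,1−x₁)} χ_A(Φ(s,t)) ds dt ≤ ∫_A z₁^{−2} dℒ²(z), where z = (z₁,z₂) denotes the coordinates in ℝ² and ℒ² is the Lebesgue measure. -/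
open Metric MeasureTheory Filter Topology Set ENNReal

/-- The parabolic stage of the Semmes family of curves for the cusp domain:
`Φ(s,t) = (x₁ + t, s·(x₁ + t)²)`. -/
def semmesParabolic (x₁ : ℝ) (p : ℝ × ℝ) : ℝ × ℝ :=
  (x₁ + p.2, p.1 * (x₁ + p.2) ^ 2)

/-- Scaling of the Lebesgue integral on the line, for nonnegative functions. -/
theorem lintegral_comp_mul_right_real {a : ℝ} (ha : a ≠ 0) {f : ℝ → ℝ≥0∞} (hf : Measurable f) :
    ∫⁻ s, f (s * a) = ENNReal.ofReal |a⁻¹| * ∫⁻ s, f s := by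
  rw [← lintegral_map (μ := volume) hf (measurable_mul_const a), Real.map_volume_mul_right ha,
    lintegral_smul_measure, smul_eq_mul]

/-- For `Φ(s,t) = (x₁ + t, s(x₁+t)²)` and every Borel set `A ⊆ ℝ²`,
`∫_{(−1,1)×(0,1−x₁)} χ_A(Φ(s,t)) ds dt ≤ ∫_A z₁⁻² dℒ²(z)`. -/
theorem semmes_parabolic_coarea (x₁ : ℝ) (hx₁ : 0 < x₁) (hx₁' : x₁ < 1)
    (A : Set (ℝ × ℝ)) (hA : MeasurableSet A) :
    (∫⁻ p in (Set.Ioo (-1 : ℝ) 1) ×ˢ (Set.Ioo (0 : ℝ) (1 - x₁)),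
        A.indicator (fun _ => (1 : ℝ≥0∞)) (semmesParabolic x₁ p)) ≤
      ∫⁻ z in A, (ENNReal.ofReal (z.1 ^ 2))⁻¹ := by
  set f : ℝ × ℝ → ℝ≥0∞ := A.indicator (fun _ => 1) with hf_def
  have hf : Measurable f := measurable_const.indicator hA
  have hΦ : Measurable (semmesParabolic x₁) := by
    unfold semmesParabolic
    fun_prop
  have hw : Measurable fun z : ℝ × ℝ => (ENNReal.ofReal (z.1 ^ 2))⁻¹ := by fun_prop
  have slice (t : ℝ) (ht : t ∈ Ioo (0 : ℝ) (1 - x₁)) :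
      ∫⁻ s in Ioo (-1 : ℝ) 1, f (semmesParabolic x₁ (s, t)) ≤
        ∫⁻ v, (ENNReal.ofReal ((x₁ + t) ^ 2))⁻¹ * f (x₁ + t, v) := by
    have hpos : 0 < (x₁ + t) ^ 2 := pow_pos (add_pos hx₁ ht.1) 2
    have hft : Measurable fun v => f (x₁ + t, v) := hf.comp measurable_prodMk_left
    calc ∫⁻ s in Ioo (-1 : ℝ) 1, f (semmesParabolic x₁ (s, t))
        ≤ ∫⁻ s, f (x₁ + t, s * (x₁ + t) ^ 2) := setLIntegral_le_lintegral _ _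
      _ = ∫⁻ v, (ENNReal.ofReal ((x₁ + t) ^ 2))⁻¹ * f (x₁ + t, v) := by
        rw [lintegral_comp_mul_right_real hpos.ne' hft, abs_of_pos (inv_pos.2 hpos),
          ENNReal.ofReal_inv_of_pos hpos, lintegral_const_mul _ hft]
  calc ∫⁻ p in Ioo (-1 : ℝ) 1 ×ˢ Ioo (0 : ℝ) (1 - x₁), f (semmesParabolic x₁ p)
      = ∫⁻ t in Ioo (0 : ℝ) (1 - x₁), ∫⁻ s in Ioo (-1 : ℝ) 1, f (semmesParabolic x₁ (s, t)) := by
        rw [Measure.volume_eq_prod, ← Measure.prod_restrict]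
        exact lintegral_prod_symm _ (hf.comp hΦ).aemeasurable
    _ ≤ ∫⁻ t in Ioo (0 : ℝ) (1 - x₁),
          ∫⁻ v, (ENNReal.ofReal ((x₁ + t) ^ 2))⁻¹ * f (x₁ + t, v) :=
        setLIntegral_mono' measurableSet_Ioo slice
    _ ≤ ∫⁻ t, ∫⁻ v, (ENNReal.ofReal ((x₁ + t) ^ 2))⁻¹ * f (x₁ + t, v) :=
        setLIntegral_le_lintegral _ _
    _ = ∫⁻ u, ∫⁻ v, (ENNReal.ofReal (u ^ 2))⁻¹ * f (u, v) :=
        lintegral_add_left_eq_self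
          (fun u => ∫⁻ v, (ENNReal.ofReal (u ^ 2))⁻¹ * f (u, v)) x₁
    _ = ∫⁻ z, (ENNReal.ofReal (z.1 ^ 2))⁻¹ * f z := by
        rw [Measure.volume_eq_prod]
        exact (lintegral_prod _ (hw.mul hf).aemeasurable).symm
    _ = ∫⁻ z in A, (ENNReal.ofReal (z.1 ^ 2))⁻¹ := by
        rw [← lintegral_indicator hA]
        congr 1 with z
        by_cases hz : z ∈ A <;> simp [hf_def, hz]
end

section
/- Let (X,d) be a metric space with a Borel regular outer measure μ that is positive and finite on all balls. Let Ω ⊂ X be open, u ∈ L¹(Ω), and let û denote the zero extension of u to X. Suppose x ∈ ∂Ω is such that there exist c_m > 0 and r₀ > 0 with μ(B(x,r)∩Ω) ≥ c_m·μ(B(x,r)) for all 0 < r < r₀, and suppose a ∈ ℝ satisfies lim_{r→0+} (1/μ(Ω∩B(x,r)))·∫_{Ω∩B(x,r)} |u − a| dμ = 0. Then û^∧(x) ≤ a ≤ û^∨(x), where û^∧ and û^∨ are the lower and upper approximate limits of û. -/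
open Metric MeasureTheory Filter Topology Set ENNReal

/-- The lower approximate limit `v^∧(x)` of `v` at `x`:
`sup { t ∈ [−∞,∞] : lim_{r→0⁺} μ(B(x,r) ∩ {v < t}) / μ(B(x,r)) = 0 }`. -/
noncomputable def lowerApproxLimit {X : Type*} [PseudoMetricSpace X] [MeasurableSpace X]
    (μ : Measure X) (v : X → ℝ) (x : X) : EReal :=
  sSup {t : EReal | Tendsto (fun r : ℝ =>
    μ (ball x r ∩ {y | (v y : EReal) < t}) / μ (ball x r)) (𝓝[>] 0) (𝓝 0)}

/-- The upper approximate limit `v^∨(x)` of `v` at `x`: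
`inf { t ∈ [−∞,∞] : lim_{r→0⁺} μ(B(x,r) ∩ {v > t}) / μ(B(x,r)) = 0 }`. -/
noncomputable def upperApproxLimit {X : Type*} [PseudoMetricSpace X] [MeasurableSpace X]
    (μ : Measure X) (v : X → ℝ) (x : X) : EReal :=
  sInf {t : EReal | Tendsto (fun r : ℝ =>
    μ (ball x r ∩ {y | t < (v y : EReal)}) / μ (ball x r)) (𝓝[>] 0) (𝓝 0)}

/-- Under a measure density condition on `Ω` at `x`, a set which contains all points of `Ω` where
`u` is `δ`-close to its trace value `a` does not have density zero at `x`. -/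
theorem not_tendsto_density_zero_of_trace {X : Type*} [PseudoMetricSpace X] [MeasurableSpace X]
    [BorelSpace X] {μ : Measure X} {x : X}
    (hpos : ∀ r : ℝ, 0 < r → 0 < μ (ball x r) ∧ μ (ball x r) ≠ ∞)
    {Ω : Set X} (hΩ : MeasurableSet Ω) {u : X → ℝ} (hu : AEMeasurable u (μ.restrict Ω))
    {cm : ℝ≥0∞} (hcm : 0 < cm) {r₀ : ℝ} (hr₀ : 0 < r₀)
    (hmd : ∀ r : ℝ, 0 < r → r < r₀ → cm * μ (ball x r) ≤ μ (ball x r ∩ Ω))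
    {a : ℝ}
    (ha : Tendsto (fun r : ℝ =>
        (∫⁻ y in Ω ∩ ball x r, ENNReal.ofReal |u y - a| ∂μ) / μ (Ω ∩ ball x r))
      (𝓝[>] 0) (𝓝 0))
    {δ : ℝ} (hδ : 0 < δ) {A : Set X} (hA : ∀ y ∈ Ω, |u y - a| < δ → y ∈ A) :
    ¬ Tendsto (fun r : ℝ => μ (ball x r ∩ A) / μ (ball x r)) (𝓝[>] 0) (𝓝 0) := by
  intro hf
  have hδ0 : ENNReal.ofReal δ ≠ 0 := by simpa using hδ
  have hlim := hf.add (ENNReal.Tendsto.div_const ha (Or.inr hδ0))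
  rw [ENNReal.zero_div, add_zero] at hlim
  refine hcm.not_ge (ge_of_tendsto hlim ?_)
  filter_upwards [Ioo_mem_nhdsGT hr₀] with r hr
  obtain ⟨hB0, hBt⟩ := hpos r hr.1
  have hdens := hmd r hr.1 hr.2
  rw [inter_comm] at hdens
  have hS0 : μ (Ω ∩ ball x r) ≠ 0 :=
    ((ENNReal.mul_pos hcm.ne' hB0.ne').trans_le hdens).ne'
  have hSB : μ (Ω ∩ ball x r) ≤ μ (ball x r) := measure_mono inter_subset_right
  have hSt : μ (Ω ∩ ball x r) ≠ ∞ := ne_top_of_le_ne_top hBt hSB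
  set I := ∫⁻ y in Ω ∩ ball x r, ENNReal.ofReal |u y - a| ∂μ with hI
  have hmeas : AEMeasurable (fun y => ENNReal.ofReal |u y - a|) (μ.restrict (Ω ∩ ball x r)) := by
    have hu' : AEMeasurable u (μ.restrict (Ω ∩ ball x r)) :=
      hu.mono_measure (Measure.restrict_mono inter_subset_left le_rfl)
    exact (continuous_abs.measurable.comp_aemeasurable (hu'.sub_const a)).ennreal_ofReal
  have hmarkov := meas_ge_le_lintegral_div hmeas hδ0 ENNReal.ofReal_ne_top
  rw [Measure.restrict_apply' (hΩ.inter measurableSet_ball), ← hI] at hmarkov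
  have hcover : μ (Ω ∩ ball x r) ≤ μ (ball x r ∩ A) + I / ENNReal.ofReal δ := by
    refine (measure_mono fun y hy => ?_).trans
      ((measure_union_le _ _).trans (add_le_add_right hmarkov _))
    rcases lt_or_ge |u y - a| δ with h | h
    · exact Or.inl ⟨hy.2, hA y hy.1 h⟩
    · exact Or.inr ⟨ENNReal.ofReal_le_ofReal h, hy⟩
  calc cm ≤ μ (Ω ∩ ball x r) / μ (ball x r) :=
        (ENNReal.le_div_iff_mul_le (Or.inl hB0.ne') (Or.inl hBt)).2 hdens
    _ ≤ (μ (ball x r ∩ A) + I / ENNReal.ofReal δ) / μ (ball x r) :=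
        ENNReal.div_le_div_right hcover _
    _ = μ (ball x r ∩ A) / μ (ball x r) + I / ENNReal.ofReal δ / μ (ball x r) :=
        ENNReal.add_div
    _ ≤ μ (ball x r ∩ A) / μ (ball x r) + I / μ (Ω ∩ ball x r) / ENNReal.ofReal δ := by
        refine add_le_add le_rfl ?_
        calc I / ENNReal.ofReal δ / μ (ball x r)
            ≤ I / ENNReal.ofReal δ / μ (Ω ∩ ball x r) := ENNReal.div_le_div_left hSB _
          _ = I / μ (Ω ∩ ball x r) / ENNReal.ofReal δ := by
              simp only [div_eq_mul_inv, mul_right_comm]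

/-- Let `μ` be positive and finite on balls, `Ω` open, `u ∈ L¹(Ω)`, and `û` the zero
extension of `u`.  If `x ∈ ∂Ω` satisfies a measure density condition
`μ(B(x,r)∩Ω) ≥ c_m μ(B(x,r))` for small `r`, and the trace value of `u` at `x` is `a`
(i.e. `lim_{r→0⁺} (1/μ(Ω∩B(x,r)))∫_{Ω∩B(x,r)}|u−a| dμ = 0`), then
`û^∧(x) ≤ a ≤ û^∨(x)`. -/
theorem trace_between_approximate_limits {X : Type*} [MetricSpace X] [MeasurableSpace X]
    [BorelSpace X] (μ : Measure X)
    (hpos : ∀ (x : X) (r : ℝ), 0 < r → 0 < μ (ball x r) ∧ μ (ball x r) ≠ ∞)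
    (Ω : Set X) (hΩ : IsOpen Ω) (u : X → ℝ) (hu : IntegrableOn u Ω μ)
    (x : X) (hx : x ∈ frontier Ω)
    (cm : ℝ≥0∞) (hcm : 0 < cm) (r₀ : ℝ) (hr₀ : 0 < r₀)
    (hmd : ∀ r : ℝ, 0 < r → r < r₀ → cm * μ (ball x r) ≤ μ (ball x r ∩ Ω))
    (a : ℝ)
    (ha : Tendsto (fun r : ℝ =>
        (∫⁻ y in Ω ∩ ball x r, ENNReal.ofReal |u y - a| ∂μ) / μ (Ω ∩ ball x r))
      (𝓝[>] 0) (𝓝 0)) :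
    lowerApproxLimit μ (Ω.indicator u) x ≤ (a : EReal) ∧
    (a : EReal) ≤ upperApproxLimit μ (Ω.indicator u) x := by
  have hdensity := fun {δ : ℝ} (hδ : 0 < δ) {A : Set X} =>
    not_tendsto_density_zero_of_trace (hpos x) hΩ.measurableSet hu.aemeasurable hcm hr₀ hmd ha
      hδ (A := A)
  constructor
  · refine sSup_le fun t ht => le_of_not_gt fun hat => ?_
    obtain ⟨s, has, hst⟩ := EReal.lt_iff_exists_real_btwn.1 hat
    refine hdensity (sub_pos.2 (EReal.coe_lt_coe_iff.1 has)) (fun y hy hya => ?_) ht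
    rw [mem_ofPred_eq, indicator_of_mem hy]
    exact (EReal.coe_lt_coe_iff.2 (by linarith [(abs_lt.1 hya).2])).trans hst
  · refine le_sInf fun t ht => le_of_not_gt fun hta => ?_
    obtain ⟨s, hts, hsa⟩ := EReal.lt_iff_exists_real_btwn.1 hta
    refine hdensity (sub_pos.2 (EReal.coe_lt_coe_iff.1 hsa)) (fun y hy hya => ?_) ht
    rw [mem_ofPred_eq, indicator_of_mem hy]
    exact hts.trans (EReal.coe_lt_coe_iff.2 (by linarith [(abs_lt.1 hya).1]))
end
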